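/- Let N ≥ 2, 1 < p < N, p < q < ∞, p* := Np/(N−p), r > p*, and let a : ℤ^N → [0,∞) satisfy a(x) → +∞ as |x| → ∞. Let u_n : ℤ^N → ℝ be finitely supported functions with sup_n ρ(∇u_n) < ∞. Then there exist a subsequence (n_k) and a function u : ℤ^N → ℝ with Σ_x |u(x)|^r < ∞ such that ‖u_{n_k} − u‖_r → 0. (That is, bounded sequences in D^{1,H}(ℤ^N) have subsequences converging in ℓ^r(ℤ^N) for every r > p*.) -/

import Mathlib

open Filter Topology
open scoped ENNReal Classical

noncomputable section

abbrev ZN (N : ℕ) := Fin N → ℤ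

def adj {N : ℕ} (x y : ZN N) : Prop := (∑ i, (x i - y i).natAbs) = 1

def eInt {N : ℕ} (g : ZN N → ZN N → ℝ) : ℝ≥0∞ :=
  (∑' e : ZN N × ZN N, if adj e.1 e.2 then ENNReal.ofReal (g e.1 e.2) else 0) / 2

def grad {N : ℕ} (u : ZN N → ℝ) (x y : ZN N) : ℝ := u y - u x

def energy {N : ℕ} (p q : ℝ) (a u : ZN N → ℝ) : ℝ≥0∞ :=
  eInt (fun x y => (1 / p) * |grad u x y| ^ p + (a x / q) * |grad u x y| ^ q)

def gradModular {N : ℕ} (p q : ℝ) (a u : ZN N → ℝ) : ℝ≥0∞ :=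
  eInt (fun x y => |grad u x y| ^ p + a x * |grad u x y| ^ q)

def vsum {N : ℕ} (r : ℝ) (u : ZN N → ℝ) : ℝ≥0∞ :=
  ∑' x : ZN N, ENNReal.ofReal (|u x| ^ r)

def Slevel {N : ℕ} (p q : ℝ) (a : ZN N → ℝ) (r t : ℝ) : ℝ≥0∞ :=
  sInf { c : ℝ≥0∞ | ∃ u : ZN N → ℝ, (Function.support u).Finite ∧
      vsum r u = ENNReal.ofReal (r * t) ∧ energy p q a u = c }

def Lop {N : ℕ} (p q : ℝ) (a u : ZN N → ℝ) (x₀ : ZN N) : ℝ :=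
  -(∑' y : ZN N, if adj x₀ y then |u y - u x₀| ^ (p - 2) * (u y - u x₀) else 0)
    - ∑' y : ZN N, if adj x₀ y then
        ((a x₀ + a y) / 2) * (|u y - u x₀| ^ (q - 2) * (u y - u x₀)) else 0

theorem abs_rpow_sub_rpow_le {x y γ : ℝ} (hx : 0 ≤ x) (hy : 0 ≤ y) (hγ : 1 ≤ γ) :
    |x ^ γ - y ^ γ| ≤ γ * (x ^ (γ - 1) + y ^ (γ - 1)) * |y - x| := by
  wlog hxy : x ≤ y generalizing x y
  · have := this hy hx (le_of_not_ge hxy)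
    rwa [abs_sub_comm, add_comm, abs_sub_comm y x]
  rcases hy.eq_or_lt with rfl | hy0
  · obtain rfl := le_antisymm hxy hx
    simp
  have hb := one_add_mul_self_le_rpow_one_add (s := (x - y) / y)
    (by rw [le_div_iff₀ hy0]; linarith) hγ
  have h1 : 1 + (x - y) / y = x / y := by field_simp; ring
  rw [h1, Real.div_rpow hx hy, le_div_iff₀ (by positivity)] at hb
  have h2 : y ^ γ = y ^ (γ - 1) * y := by
    rw [← Real.rpow_add_one hy0.ne']; simp
  have h3 : (1 + γ * ((x - y) / y)) * y ^ γ = y ^ γ - γ * y ^ (γ - 1) * (y - x) := by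
    rw [h2]; field_simp; ring
  rw [h3] at hb
  have hm : x ^ γ ≤ y ^ γ := Real.rpow_le_rpow hx hxy (by linarith)
  rw [abs_sub_comm, abs_of_nonneg (by linarith), abs_of_nonneg (by linarith : 0 ≤ y - x)]
  have : 0 ≤ γ * x ^ (γ - 1) * (y - x) := by
    have := sub_nonneg.2 hxy
    positivity
  linarith

theorem ofReal_abs_le_tsum_forward_diff (f : ℤ → ℝ) (hf : (Function.support f).Finite) (s : ℤ) :
    ENNReal.ofReal |f s| ≤ ∑' t : ℤ, ENNReal.ofReal |f (t + 1) - f t| := by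
  have hinj : Function.Injective fun j : ℕ => s + (j : ℤ) := fun i j h => by simpa using h
  obtain ⟨M, hM⟩ : ∃ M : ℕ, f (s + (M : ℤ)) = 0 := by
    by_contra! h
    exact Set.infinite_univ ((hf.preimage hinj.injOn).subset fun j _ => h j)
  have h1 : f s = -∑ j ∈ Finset.range M, (f (s + (j : ℤ) + 1) - f (s + (j : ℤ))) := by
    have := Finset.sum_range_sub (fun j : ℕ => f (s + (j : ℤ))) M
    simp only [Nat.cast_add, Nat.cast_one, ← add_assoc] at this
    rw [this, hM]; simp
  calc ENNReal.ofReal |f s|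
      ≤ ENNReal.ofReal (∑ j ∈ Finset.range M, |f (s + (j : ℤ) + 1) - f (s + (j : ℤ))|) := by
        apply ENNReal.ofReal_le_ofReal
        rw [h1, abs_neg]
        exact Finset.abs_sum_le_sum_abs _ _
    _ = ∑ j ∈ Finset.range M, ENNReal.ofReal |f (s + (j : ℤ) + 1) - f (s + (j : ℤ))| :=
        ENNReal.ofReal_sum_of_nonneg fun _ _ => abs_nonneg _
    _ ≤ ∑' j : ℕ, ENNReal.ofReal |f (s + (j : ℤ) + 1) - f (s + (j : ℤ))| :=
        ENNReal.sum_le_tsum _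
    _ ≤ _ := ENNReal.tsum_comp_le_tsum_of_injective hinj
        (fun t : ℤ => ENNReal.ofReal |f (t + 1) - f t|)

theorem pi_count_eq_count {N : ℕ} :
    MeasureTheory.Measure.pi (fun _ : Fin N => (MeasureTheory.Measure.count : MeasureTheory.Measure ℤ))
      = MeasureTheory.Measure.count := by
  refine MeasureTheory.Measure.ext_of_singleton fun x => ?_
  rw [MeasureTheory.Measure.pi_singleton]
  simp

theorem tsum_rpow_le_tsum_forward_diff_rpow {N : ℕ} (hN : 2 ≤ N) (v : ZN N → ℝ)
    (hv : (Function.support v).Finite) :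
    ∑' x, ENNReal.ofReal |v x| ^ ((N : ℝ) / (N - 1)) ≤
      (∑' x, ∑ i, ENNReal.ofReal |v (x + Pi.single i 1) - v x|) ^ ((N : ℝ) / (N - 1)) := by
  have hN' : (2 : ℝ) ≤ N := by exact_mod_cast hN
  have hc : Real.HolderConjugate (Fintype.card (Fin N)) ((N : ℝ) / (N - 1)) := by
    rw [Fintype.card_fin]
    exact Real.HolderConjugate.conjExponent (by linarith)
  set D : ZN N → ℝ≥0∞ := fun x => ∑ i, ENNReal.ofReal |v (x + Pi.single i 1) - v x|
  have key := MeasureTheory.lintegral_prod_lintegral_pow_le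
    (fun _ : Fin N => (MeasureTheory.Measure.count : MeasureTheory.Measure ℤ)) hc
    (f := D) Measurable.of_discrete
  rw [pi_count_eq_count, MeasureTheory.lintegral_count, MeasureTheory.lintegral_count] at key
  refine le_trans (ENNReal.tsum_le_tsum fun x => ?_) key
  have hline : ∀ i : Fin N, ENNReal.ofReal |v x| ≤
      ∫⁻ t, D (Function.update x i t) ∂MeasureTheory.Measure.count := by
    intro i
    rw [MeasureTheory.lintegral_count]
    have hinj : Function.Injective (fun t : ℤ => Function.update x i t) :=
      Function.update_injective x i
    have := ofReal_abs_le_tsum_forward_diff (fun t => v (Function.update x i t))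
      (hv.preimage hinj.injOn) (x i)
    simp only [Function.update_eq_self] at this
    refine this.trans (ENNReal.tsum_le_tsum fun t => ?_)
    have hup : Function.update x i (t + 1) = Function.update x i t + Pi.single i 1 := by
      ext j
      by_cases hj : j = i
      · subst hj; simp
      · simp [hj]
    rw [hup]
    exact Finset.single_le_sum
      (f := fun i' => ENNReal.ofReal |v (Function.update x i t + Pi.single i' 1)
        - v (Function.update x i t)|) (fun _ _ => zero_le) (Finset.mem_univ i)
  calc ENNReal.ofReal |v x| ^ ((N : ℝ) / (N - 1))
      = ∏ _i : Fin N, ENNReal.ofReal |v x| ^ ((1 : ℝ) / (Fintype.card (Fin N) - 1 : ℝ)) := by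
        rw [Finset.prod_const, Finset.card_univ, Fintype.card_fin, ← ENNReal.rpow_natCast,
          ← ENNReal.rpow_mul]
        congr 1
        ring
    _ ≤ _ := by
        refine Finset.prod_le_prod' fun i _ => ?_
        refine ENNReal.rpow_le_rpow (hline i) ?_
        rw [Fintype.card_fin]
        exact div_nonneg zero_le_one (by linarith)

theorem adj_add_single {N : ℕ} (x : ZN N) (i : Fin N) : adj x (x + Pi.single i 1) := by
  simp [adj, Pi.single_apply, apply_ite Int.natAbs]

theorem tsum_forward_modular_le {N : ℕ} {p q : ℝ} {a u : ZN N → ℝ} {C : ℝ≥0∞}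
    (h : gradModular p q a u ≤ C) (i : Fin N) :
    ∑' x, ENNReal.ofReal (|u (x + Pi.single i 1) - u x| ^ p
      + a x * |u (x + Pi.single i 1) - u x| ^ q) ≤ C * 2 := by
  rw [gradModular, eInt, ENNReal.div_le_iff (by simp) (by simp)] at h
  refine le_trans ?_ h
  have hinj : Function.Injective fun x : ZN N => (x, x + Pi.single i 1) :=
    fun x y hxy => (Prod.mk.inj hxy).1
  refine le_trans (ENNReal.tsum_le_tsum fun _ => ?_) (ENNReal.tsum_comp_le_tsum_of_injective hinj _)
  simp only [adj_add_single, if_true, grad, le_refl]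

theorem tsum_forward_diff_rpow_le {N : ℕ} {p q : ℝ} {a u : ZN N → ℝ} {C : ℝ≥0∞} (hp : 0 ≤ p)
    (ha : ∀ x, 0 ≤ a x) (h : gradModular p q a u ≤ C) (i : Fin N) :
    ∑' x, ENNReal.ofReal |u (x + Pi.single i 1) - u x| ^ p ≤ C * 2 := by
  refine le_trans (ENNReal.tsum_le_tsum fun x => ?_) (tsum_forward_modular_le h i)
  rw [ENNReal.ofReal_rpow_of_nonneg (abs_nonneg _) hp]
  apply ENNReal.ofReal_le_ofReal
  have := mul_nonneg (ha x) (Real.rpow_nonneg (abs_nonneg (u (x + Pi.single i 1) - u x)) q)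
  linarith

theorem mul_forward_diff_rpow_le {N : ℕ} {p q : ℝ} {a u : ZN N → ℝ} {C : ℝ≥0∞} (hC : C ≠ ⊤)
    (h : gradModular p q a u ≤ C) (i : Fin N) (x : ZN N) :
    a x * |u (x + Pi.single i 1) - u x| ^ q ≤ (C * 2).toReal := by
  have h1 := (ENNReal.le_tsum x).trans (tsum_forward_modular_le h i)
  rw [ENNReal.ofReal_le_iff_le_toReal (ENNReal.mul_ne_top hC (by simp))] at h1
  have := Real.rpow_nonneg (abs_nonneg (u (x + Pi.single i 1) - u x)) p
  linarith

theorem vsum_eq_tsum_rpow {N : ℕ} {s : ℝ} (hs : 0 ≤ s) (u : ZN N → ℝ) :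
    vsum s u = ∑' x, ENNReal.ofReal |u x| ^ s :=
  tsum_congr fun _ => (ENNReal.ofReal_rpow_of_nonneg (abs_nonneg _) hs).symm

theorem vsum_ne_top_of_finite_support {N : ℕ} {s : ℝ} (hs : 0 < s) {u : ZN N → ℝ}
    (hu : (Function.support u).Finite) : vsum s u ≠ ⊤ := by
  rw [vsum, tsum_eq_sum (s := hu.toFinset)]
  · exact ENNReal.sum_ne_top.2 fun _ _ => ENNReal.ofReal_ne_top
  · intro x hx
    have : u x = 0 := by simpa using hx
    simp [this, Real.zero_rpow hs.ne']

/-- Hölder's inequality for series with values in `[0, ∞]`. -/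
theorem tsum_mul_le_rpow_mul_rpow {ι : Type*} (f g : ι → ℝ≥0∞) {p q : ℝ}
    (hpq : p.HolderConjugate q) :
    ∑' x, f x * g x ≤ (∑' x, f x ^ p) ^ (1 / p) * (∑' x, g x ^ q) ^ (1 / q) := by
  let _ : MeasurableSpace ι := ⊤
  have := ENNReal.lintegral_mul_le_Lp_mul_Lq (MeasureTheory.Measure.count : MeasureTheory.Measure ι)
    hpq (f := f) (g := g) Measurable.of_discrete.aemeasurable Measurable.of_discrete.aemeasurable
  simpa [MeasureTheory.lintegral_count] using this

/-- Discrete Sobolev inequality: a bound on the gradient modular gives a bound in `ℓ^{p*}`. -/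
theorem exists_vsum_le_of_gradModular_le {N : ℕ} (hN : 2 ≤ N) {p q : ℝ} (hp : 1 < p)
    (hpN : p < N) {C : ℝ≥0∞} (hC : C ≠ ⊤) :
    ∃ K : ℝ≥0∞, K ≠ ⊤ ∧ ∀ a u : ZN N → ℝ, (∀ x, 0 ≤ a x) → (Function.support u).Finite →
      gradModular p q a u ≤ C → vsum (N * p / (N - p)) u ≤ K := by
  have hN' : (2 : ℝ) ≤ N := by exact_mod_cast hN
  have hNp : (0 : ℝ) < N - p := by linarith
  have hN1 : (0 : ℝ) < N - 1 := by linarith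
  set s : ℝ := N * p / (N - p) with hs
  set γ : ℝ := p * (N - 1) / (N - p) with hγ
  set m : ℝ := N / (N - 1) with hm
  set p' : ℝ := p / (p - 1) with hp'
  have hs0 : 0 < s := by positivity
  have hm0 : 0 < m := by positivity
  have hγ1 : 1 < γ := by rw [hγ, lt_div_iff₀ hNp]; nlinarith
  have hγm : γ * m = s := by rw [hγ, hm, hs]; field_simp
  have hp1 : p - 1 ≠ 0 := by linarith
  have hγp : (γ - 1) * p' = s := by rw [hγ, hp', hs]; field_simp; ring
  have hconj : p'.HolderConjugate p := (Real.HolderConjugate.conjExponent hp).symm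
  set θ : ℝ := 1 - m / p' with hθ
  have hθ0 : 0 < θ := by
    have : θ = (N - p) / ((N - 1) * p) := by rw [hθ, hm, hp']; field_simp; ring
    rw [this]; positivity
  set A : ℝ≥0∞ := ∑ _i : Fin N, ENNReal.ofReal γ * (2 * (C * 2) ^ (1 / p)) with hA
  have hAtop : A ≠ ⊤ := by
    refine ENNReal.sum_ne_top.2 fun _ _ => ENNReal.mul_ne_top ENNReal.ofReal_ne_top
      (ENNReal.mul_ne_top (by simp) (ENNReal.rpow_ne_top_of_nonneg (by positivity) ?_))
    exact ENNReal.mul_ne_top hC (by simp)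
  refine ⟨(A ^ m) ^ (1 / θ), ?_, fun a u ha hu h => ?_⟩
  · exact ENNReal.rpow_ne_top_of_nonneg (by positivity)
      (ENNReal.rpow_ne_top_of_nonneg hm0.le hAtop)
  set S := vsum s u
  have hStop : S ≠ ⊤ := vsum_ne_top_of_finite_support hs0 hu
  set w : ZN N → ℝ≥0∞ := fun x => ENNReal.ofReal |u x|
  have hSw : S = ∑' x, w x ^ s := vsum_eq_tsum_rpow hs0.le u
  set g : Fin N → ZN N → ℝ≥0∞ := fun i x => ENNReal.ofReal |u (x + Pi.single i 1) - u x|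
  have hg : ∀ i, ∑' x, g i x ^ p ≤ C * 2 :=
    fun i => tsum_forward_diff_rpow_le (by linarith) ha h i
  have hholder : ∀ (i : Fin N) (τ : ZN N ≃ ZN N),
      ∑' x, w (τ x) ^ (γ - 1) * g i x ≤ S ^ (1 / p') * (C * 2) ^ (1 / p) := by
    intro i τ
    refine (tsum_mul_le_rpow_mul_rpow _ _ hconj).trans ?_
    have h1 : ∑' x, (w (τ x) ^ (γ - 1)) ^ p' = S := by
      rw [hSw, ← τ.tsum_eq fun x => w x ^ s]
      exact tsum_congr fun x => by rw [← ENNReal.rpow_mul, hγp]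
    rw [h1]
    gcongr
    exact hg i
  have hsupp : (Function.support fun x => |u x| ^ γ).Finite := by
    refine hu.subset fun x hx hx0 => hx ?_
    simp only [hx0, abs_zero]
    exact Real.zero_rpow (by linarith)
  have h1 := tsum_rpow_le_tsum_forward_diff_rpow hN (fun x => |u x| ^ γ) hsupp
  have h2 : ∑' x, ENNReal.ofReal |(|u x| ^ γ)| ^ m = S := by
    rw [hSw]
    refine tsum_congr fun x => ?_
    rw [abs_of_nonneg (by positivity), ← ENNReal.ofReal_rpow_of_nonneg (abs_nonneg _) (by linarith),
      ← ENNReal.rpow_mul, hγm]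
  have hpt : ∀ x i, ENNReal.ofReal |(|u (x + Pi.single i 1)| ^ γ) - |u x| ^ γ| ≤
      ENNReal.ofReal γ * (w (x + Pi.single i 1) ^ (γ - 1) * g i x + w x ^ (γ - 1) * g i x) := by
    intro x i
    have h3 : |(|u (x + Pi.single i 1)| ^ γ) - |u x| ^ γ| ≤
        γ * ((|u (x + Pi.single i 1)| ^ (γ - 1) + |u x| ^ (γ - 1)) *
          |u (x + Pi.single i 1) - u x|) := by
      refine (abs_rpow_sub_rpow_le (abs_nonneg _) (abs_nonneg _) hγ1.le).trans ?_
      rw [mul_assoc, abs_sub_comm |u x|]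
      exact mul_le_mul_of_nonneg_left (mul_le_mul_of_nonneg_left
        (abs_abs_sub_abs_le_abs_sub _ _) (by positivity)) (by linarith)
    refine (ENNReal.ofReal_le_ofReal h3).trans_eq ?_
    rw [ENNReal.ofReal_mul (by linarith), ENNReal.ofReal_mul (by positivity),
      ENNReal.ofReal_add (by positivity) (by positivity),
      ← ENNReal.ofReal_rpow_of_nonneg (abs_nonneg _) (by linarith),
      ← ENNReal.ofReal_rpow_of_nonneg (abs_nonneg _) (by linarith), add_mul]
  have h4 : ∑' x, ∑ i, ENNReal.ofReal |(|u (x + Pi.single i 1)| ^ γ) - |u x| ^ γ| ≤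
      A * S ^ (1 / p') := by
    rw [Summable.tsum_finsetSum fun _ _ => ENNReal.summable, hA, Finset.sum_mul]
    refine Finset.sum_le_sum fun i _ => ?_
    refine (ENNReal.tsum_le_tsum fun x => hpt x i).trans ?_
    rw [ENNReal.tsum_mul_left, ENNReal.tsum_add]
    have e1 := hholder i (Equiv.addRight (Pi.single i 1))
    have e2 := hholder i (Equiv.refl _)
    simp only [Equiv.coe_addRight, Equiv.refl_apply] at e1 e2
    calc _ ≤ ENNReal.ofReal γ * (S ^ (1 / p') * (C * 2) ^ (1 / p)
          + S ^ (1 / p') * (C * 2) ^ (1 / p)) := by gcongr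
      _ = _ := by ring
  rw [h2] at h1
  have h5 : S ≤ A ^ m * S ^ (m / p') := by
    refine h1.trans ((ENNReal.rpow_le_rpow h4 hm0.le).trans_eq ?_)
    rw [ENNReal.mul_rpow_of_nonneg _ _ hm0.le, ← ENNReal.rpow_mul]
    congr 2
    ring
  rcases eq_or_ne S 0 with hS0 | hS0
  · rw [hS0]; exact zero_le
  have h6 : S ^ θ ≤ A ^ m := by
    rw [hθ, ENNReal.rpow_sub _ _ hS0 hStop, ENNReal.rpow_one]
    exact ENNReal.div_le_of_le_mul h5
  calc S = (S ^ θ) ^ (1 / θ) := by rw [← ENNReal.rpow_mul, mul_one_div_cancel hθ0.ne', ENNReal.rpow_one]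
    _ ≤ _ := ENNReal.rpow_le_rpow h6 (by positivity)

theorem abs_le_of_vsum_le {N : ℕ} {s : ℝ} (hs : 0 < s) {K : ℝ≥0∞} (hK : K ≠ ⊤) {u : ZN N → ℝ}
    (hu : vsum s u ≤ K) (x : ZN N) : |u x| ≤ K.toReal ^ (1 / s) := by
  have h1 := (ENNReal.le_tsum x).trans hu
  rw [ENNReal.ofReal_le_iff_le_toReal hK] at h1
  calc |u x| = (|u x| ^ s) ^ (1 / s) := by
        rw [← Real.rpow_mul (abs_nonneg _), mul_one_div_cancel hs.ne', Real.rpow_one]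
    _ ≤ _ := Real.rpow_le_rpow (by positivity) h1 (by positivity)

theorem vsum_le_of_abs_le {N : ℕ} {s r η : ℝ} (hs : 0 < s) (hsr : s < r) {u : ZN N → ℝ}
    (hu : ∀ x, |u x| ≤ η) : vsum r u ≤ ENNReal.ofReal (η ^ (r - s)) * vsum s u := by
  rw [vsum, vsum, ← ENNReal.tsum_mul_left]
  refine ENNReal.tsum_le_tsum fun x => ?_
  have hη : 0 ≤ η := (abs_nonneg _).trans (hu x)
  rw [← ENNReal.ofReal_mul (by positivity)]
  apply ENNReal.ofReal_le_ofReal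
  have h1 : |u x| ^ r = |u x| ^ (r - s) * |u x| ^ s := by
    rw [← Real.rpow_add_of_nonneg (abs_nonneg _) (by linarith) hs.le, sub_add_cancel]
  rw [h1]
  exact mul_le_mul_of_nonneg_right
    (Real.rpow_le_rpow (abs_nonneg _) (hu x) (by linarith)) (by positivity)

theorem vsum_sub_le {N : ℕ} {s : ℝ} (hs : 0 < s) (u v : ZN N → ℝ) :
    vsum s (fun x => u x - v x) ≤ ENNReal.ofReal (2 ^ s) * (vsum s u + vsum s v) := by
  rw [vsum, vsum, vsum, ← ENNReal.tsum_add, ← ENNReal.tsum_mul_left]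
  refine ENNReal.tsum_le_tsum fun x => ?_
  rw [← ENNReal.ofReal_add (by positivity) (by positivity), ← ENNReal.ofReal_mul (by positivity)]
  apply ENNReal.ofReal_le_ofReal
  have h1 : |u x - v x| ≤ 2 * max |u x| |v x| := by
    have := abs_sub (u x) (v x)
    have := le_max_left |u x| |v x|
    have := le_max_right |u x| |v x|
    linarith
  refine (Real.rpow_le_rpow (abs_nonneg _) h1 hs.le).trans ?_
  rw [Real.mul_rpow (by norm_num) (by positivity)]
  refine mul_le_mul_of_nonneg_left ?_ (by positivity)
  have hu : 0 ≤ |u x| ^ s := by positivity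
  have hv : 0 ≤ |v x| ^ s := by positivity
  rcases max_choice |u x| |v x| with h | h <;> rw [h] <;> linarith

theorem vsum_le_of_tendsto {N : ℕ} {s : ℝ} (hs : 0 < s) {K : ℝ≥0∞} {u : ℕ → ZN N → ℝ}
    {v : ZN N → ℝ} (hu : ∀ n, vsum s (u n) ≤ K)
    (huv : ∀ x, Tendsto (fun n => u n x) atTop (𝓝 (v x))) : vsum s v ≤ K := by
  rw [vsum, ENNReal.tsum_eq_iSup_sum]
  refine iSup_le fun t => ?_
  have h : Tendsto (fun n => ∑ x ∈ t, ENNReal.ofReal (|u n x| ^ s)) atTop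
      (𝓝 (∑ x ∈ t, ENNReal.ofReal (|v x| ^ s))) := tendsto_finsetSum t fun x _ =>
    ENNReal.tendsto_ofReal ((huv x).abs.rpow_const (Or.inr hs.le))
  exact le_of_tendsto' h fun n => (ENNReal.sum_le_tsum t).trans (hu n)

/-- Functions with bounded gradient modular and bounded `ℓ^s` norm are uniformly small outside a
finite set, since the blow-up of `a` makes their gradients uniformly small at infinity. -/
theorem exists_finite_forall_abs_le {N : ℕ} (i : Fin N) {p q s : ℝ} (hq : 0 < q) (hs : 0 < s)
    {a : ZN N → ℝ} (hainf : Tendsto a cofinite atTop) {C K : ℝ≥0∞} (hC : C ≠ ⊤) (hK : K ≠ ⊤)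
    {ε : ℝ} (hε : 0 < ε) :
    ∃ F : Set (ZN N), F.Finite ∧ ∀ u : ZN N → ℝ, vsum s u ≤ K → gradModular p q a u ≤ C →
      ∀ x ∉ F, |u x| ≤ ε := by
  have hε2 : 0 < (ε / 2) ^ s := by positivity
  obtain ⟨M, hM⟩ := exists_nat_gt (K.toReal / (ε / 2) ^ s)
  rw [div_lt_iff₀ hε2] at hM
  set δ : ℝ := ε / (2 * (M + 1)) with hδ
  have hδ0 : 0 < δ := by positivity
  have hMδ : M * δ ≤ ε / 2 := by
    rw [hδ, mul_div_assoc', div_le_div_iff₀ (by positivity) (by norm_num)]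
    nlinarith
  set c : ℝ := (C * 2).toReal
  set T : ℕ → ZN N → ZN N := fun j x => x + Pi.single i (j : ℤ) with hT
  have hTinj : ∀ j, Function.Injective (T j) := fun j => add_left_injective _
  have hTx : ∀ x, Function.Injective fun j => T j x := by
    intro x j k hjk
    have := congrFun hjk i
    simpa [hT] using this
  have hfin : {y | ¬ c / δ ^ q < a y}.Finite := hainf.eventually_gt_atTop (c / δ ^ q)
  refine ⟨⋃ j ∈ Finset.range M, T j ⁻¹' {y | ¬ c / δ ^ q < a y},
    (Finset.range M).finite_toSet.biUnion fun j _ => hfin.preimage (hTinj j).injOn, ?_⟩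
  intro u hu hmod x hx
  have hx' : ∀ j < M, c / δ ^ q < a (T j x) := by
    intro j hj
    by_contra hcon
    exact hx (Set.mem_biUnion (Finset.mem_coe.2 (Finset.mem_range.2 hj)) hcon)
  by_contra! hlt
  have hstep : ∀ j < M, |u (T (j + 1) x) - u (T j x)| ≤ δ := by
    intro j hj
    have h1 := mul_forward_diff_rpow_le hC hmod i (T j x)
    have h2 : T j x + Pi.single i 1 = T (j + 1) x := by
      simp only [hT, add_assoc, ← Pi.single_add, Nat.cast_add, Nat.cast_one]
    rw [h2] at h1
    by_contra! h3
    have h4 := hx' j hj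
    rw [div_lt_iff₀ (by positivity)] at h4
    have h5 : δ ^ q ≤ |u (T (j + 1) x) - u (T j x)| ^ q := Real.rpow_le_rpow hδ0.le h3.le hq.le
    have h6 : 0 ≤ a (T j x) :=
      (div_nonneg ENNReal.toReal_nonneg (by positivity)).trans (hx' j hj).le
    have h7 := mul_le_mul_of_nonneg_left h5 h6
    linarith
  have hlow : ∀ j ≤ M, ε - j * δ ≤ |u (T j x)| := by
    intro j
    induction j with
    | zero => intro _; simpa [hT] using hlt.le
    | succ j ih =>
      intro hj
      have h1 := ih (by omega)
      have h2 := hstep j (by omega)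
      have h3 := abs_sub_abs_le_abs_sub (u (T j x)) (u (T (j + 1) x))
      rw [abs_sub_comm] at h3
      push_cast
      linarith
  have hsum : ∑ _j ∈ Finset.range M, ENNReal.ofReal ((ε / 2) ^ s) ≤ K := by
    calc _ ≤ ∑ j ∈ Finset.range M, ENNReal.ofReal (|u (T j x)| ^ s) := by
          refine Finset.sum_le_sum fun j hj => ENNReal.ofReal_le_ofReal
            (Real.rpow_le_rpow (by positivity) ?_ hs.le)
          have hjM := (Finset.mem_range.1 hj).le
          have h1 := hlow j hjM
          have h2 : (j : ℝ) * δ ≤ M * δ := by gcongr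
          linarith
      _ ≤ ∑' j, ENNReal.ofReal (|u (T j x)| ^ s) := ENNReal.sum_le_tsum _
      _ ≤ vsum s u := ENNReal.tsum_comp_le_tsum_of_injective (hTx x)
          fun y => ENNReal.ofReal (|u y| ^ s)
      _ ≤ K := hu
  rw [Finset.sum_const, Finset.card_range, nsmul_eq_mul, ← ENNReal.ofReal_natCast,
    ← ENNReal.ofReal_mul (by positivity), ENNReal.ofReal_le_iff_le_toReal hK] at hsum
  linarith

/-- compact embedding `D^{1,H}(ℤ^N) ↪↪ ℓ^r(ℤ^N)` for `r > p*` when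
`a(x) → +∞` as `|x| → ∞`: bounded sequences have subsequences converging in `ℓ^r`. -/
theorem statement16 {N : ℕ} (hN : 2 ≤ N) (p q : ℝ) (hp : 1 < p) (hpN : p < (N : ℝ))
    (hpq : p < q) (pstar : ℝ) (hpstar : pstar = (N : ℝ) * p / ((N : ℝ) - p))
    (r : ℝ) (hr : pstar < r)
    (a : ZN N → ℝ) (ha : ∀ x, 0 ≤ a x) (hainf : Tendsto a cofinite atTop)
    (u : ℕ → ZN N → ℝ) (hufin : ∀ n, (Function.support (u n)).Finite)
    (hbd : ∃ C : ℝ≥0∞, C ≠ ⊤ ∧ ∀ n, gradModular p q a (u n) ≤ C) :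
    ∃ φ : ℕ → ℕ, StrictMono φ ∧ ∃ v : ZN N → ℝ, vsum r v < ⊤ ∧
      Tendsto (fun k => (vsum r (fun x => u (φ k) x - v x)) ^ (1 / r)) atTop (𝓝 0) := by
  obtain ⟨C, hC, hmod⟩ := hbd
  obtain ⟨K, hK, hKbd⟩ := exists_vsum_le_of_gradModular_le (q := q) hN hp hpN hC
  have hs : 0 < pstar := by
    have : 0 < (N : ℝ) - p := by linarith
    rw [hpstar]
    exact div_pos (mul_pos (by linarith) (by linarith)) this
  have hu : ∀ n, vsum pstar (u n) ≤ K := fun n =>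
    hpstar ▸ hKbd a (u n) ha (hufin n) (hmod n)
  set B : ℝ := K.toReal ^ (1 / pstar)
  have hcpt : IsCompact (Set.univ.pi fun _ : ZN N => Set.Icc (-B) B) :=
    isCompact_univ_pi fun _ => isCompact_Icc
  obtain ⟨v, -, φ, hφ, hlim⟩ := hcpt.tendsto_subseq (x := u)
    fun n x _ => abs_le.1 (abs_le_of_vsum_le hs hK (hu n) x)
  have hlim' : ∀ x, Tendsto (fun k => u (φ k) x) atTop (𝓝 (v x)) := tendsto_pi_nhds.1 hlim
  have hv : vsum pstar v ≤ K := vsum_le_of_tendsto hs (fun k => hu (φ k)) hlim'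
  refine ⟨φ, hφ, v, ?_, ?_⟩
  · exact (vsum_le_of_abs_le hs hr (abs_le_of_vsum_le hs hK hv)).trans_lt
      (ENNReal.mul_lt_top ENNReal.ofReal_lt_top (hv.trans_lt hK.lt_top))
  set T : ℝ≥0∞ := ENNReal.ofReal (2 ^ pstar) * (K + K)
  have hT : T ≠ ⊤ := ENNReal.mul_ne_top ENNReal.ofReal_ne_top (ENNReal.add_ne_top.2 ⟨hK, hK⟩)
  have hr0 : 0 < r := hs.trans hr
  have hdiff : ∀ k, vsum pstar (fun x => u (φ k) x - v x) ≤ T := fun k =>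
    (vsum_sub_le hs _ _).trans (mul_le_mul_right (add_le_add (hu _) hv) _)
  suffices h : Tendsto (fun k => vsum r (fun x => u (φ k) x - v x)) atTop (𝓝 0) by
    have h1 := (ENNReal.continuous_rpow_const (y := 1 / r)).tendsto 0 |>.comp h
    rwa [ENNReal.zero_rpow_of_pos (by positivity)] at h1
  rw [ENNReal.tendsto_nhds_zero]
  intro ε hε
  have hcont : Tendsto (fun η : ℝ => ENNReal.ofReal (η ^ (r - pstar)) * T) (𝓝[>] 0) (𝓝 0) := by
    have h1 : Tendsto (fun η : ℝ => η ^ (r - pstar)) (𝓝 0) (𝓝 0) := by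
      have := (Real.continuousAt_rpow_const 0 (r - pstar) (Or.inr (by linarith))).tendsto
      rwa [Real.zero_rpow (by linarith)] at this
    have h2 := ENNReal.Tendsto.mul_const (ENNReal.tendsto_ofReal h1) (Or.inr hT)
    rw [ENNReal.ofReal_zero, zero_mul] at h2
    exact h2.mono_left nhdsWithin_le_nhds
  obtain ⟨η, hηε, hη⟩ := ((ENNReal.tendsto_nhds_zero.1 hcont ε hε).and self_mem_nhdsWithin).exists
  have hη0 : 0 < η := hη
  obtain ⟨F, hF, hFu⟩ := exists_finite_forall_abs_le (p := p) ⟨0, by omega⟩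
    (by linarith : 0 < q) hs hainf hC hK (half_pos hη0)
  have hFv : ∀ x ∉ F, |v x| ≤ η / 2 := fun x hx =>
    le_of_tendsto' (hlim' x).abs fun k => hFu _ (hu _) (hmod _) x hx
  have hnear : ∀ᶠ k in atTop, ∀ x ∈ F, |u (φ k) x - v x| < η :=
    (eventually_all_finite hF).2 fun x _ => Metric.tendsto_nhds.1 (hlim' x) η hη0
  filter_upwards [hnear] with k hk
  have hsup : ∀ x, |u (φ k) x - v x| ≤ η := by
    intro x
    by_cases hx : x ∈ F
    · exact (hk x hx).le
    · have h1 := hFu _ (hu (φ k)) (hmod _) x hx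
      have h2 := hFv x hx
      have h3 := abs_sub (u (φ k) x) (v x)
      linarith
  exact ((vsum_le_of_abs_le hs hr hsup).trans (mul_le_mul_right (hdiff k) _)).trans hηε
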